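/- Let Ω ⊂ ℝ² be a bounded open set with smooth boundary and let K ⊂ Ω be compact. There exists c = c(b₁, b₂, C₁, C₂, K, Ω) such that for all V, W : Ω̄ → ℝ and u, v ∈ C²(Ω̄) satisfying -Δu = V e^{v} and -Δv = W e^{u} in Ω, u = 0 and v = 0 on ∂Ω, 0 ≤ V ≤ b₁ and 0 ≤ W ≤ b₂ on Ω, ∫_Ω e^{u} dx ≤ C₁ and ∫_Ω e^{v} dx ≤ C₂, one has sup_K u ≤ c and sup_K v ≤ c. In other words, for the system with bounded energies there are no interior blow-up points. -/

import Mathlib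

open MeasureTheory Real Filter Topology Metric Set
open scoped RealInnerProductSpace ENNReal NNReal

noncomputable section

abbrev E2 : Type := EuclideanSpace ℝ (Fin 2)

/-- The Laplacian `Δ = ∂₁₁ + ∂₂₂` on `ℝ²`. -/
noncomputable def lap (u : E2 → ℝ) (x : E2) : ℝ :=
  ∑ i : Fin 2,
    fderiv ℝ (fun y => fderiv ℝ u y (EuclideanSpace.single i 1)) x (EuclideanSpace.single i 1)

/-- A planar set has smooth boundary: near each boundary point the set is the sublevel set
of a smooth local defining function with nonvanishing derivative. -/
def SmoothBoundary (Ω : Set E2) : Prop :=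
  ∀ x ∈ frontier Ω, ∃ (U : Set E2) (f : E2 → ℝ),
    IsOpen U ∧ x ∈ U ∧ ContDiff ℝ (⊤ : ℕ∞) f ∧ (∀ y ∈ U, fderiv ℝ f y ≠ 0) ∧
    Ω ∩ U = {y ∈ U | f y < 0} ∧ frontier Ω ∩ U = {y ∈ U | f y = 0}

def ev (θ : ℝ) : E2 := Real.cos θ • EuclideanSpace.single 0 1 + Real.sin θ • EuclideanSpace.single 1 1
def ew (θ : ℝ) : E2 := -Real.sin θ • EuclideanSpace.single 0 1 + Real.cos θ • EuclideanSpace.single 1 1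

lemma norm_ev (θ : ℝ) : ‖ev θ‖ = 1 := by
  simp [ev, EuclideanSpace.norm_eq, Fin.sum_univ_two]

lemma hasDerivAt_ev (θ : ℝ) : HasDerivAt ev (ew θ) θ := by
  unfold ev ew
  exact ((Real.hasDerivAt_cos θ).smul_const _).add ((Real.hasDerivAt_sin θ).smul_const _)

lemma hasDerivAt_ew (θ : ℝ) : HasDerivAt ew (-ev θ) θ := by
  have := ((Real.hasDerivAt_sin θ).neg.smul_const (EuclideanSpace.single 0 1 : E2)).add
    ((Real.hasDerivAt_cos θ).smul_const (EuclideanSpace.single 1 1 : E2))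
  unfold ew
  refine this.congr_deriv ?_
  unfold ev
  rw [neg_add, neg_smul, neg_smul]

lemma continuous_ev : Continuous ev := by unfold ev; fun_prop
lemma continuous_ew : Continuous ew := by unfold ew; fun_prop

lemma polar_int (G : E2 → ℝ) (x0 : E2) (R : ℝ) :
    ∫ y in ball x0 R, G y = ∫ p in Ioo 0 R ×ˢ Ioo (-π) π, p.1 * G (x0 + p.1 • ev p.2) := by
  rw [← integral_indicator measurableSet_ball, ← integral_add_left_eq_self _ x0]
  set g : E2 → ℝ := fun x => (ball x0 R).indicator G (x0 + x) with hg
  have h1 : ∫ x, g x = ∫ q : ℝ × ℝ, g (WithLp.toLp 2 ((MeasurableEquiv.finTwoArrow (α := ℝ)).symm q)) := by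
    rw [(volume_preserving_finTwoArrow ℝ).symm.integral_comp' (g := fun z => g (WithLp.toLp 2 z))]
    rw [(PiLp.volume_preserving_toLp (Fin 2)).integral_comp
      (MeasurableEquiv.toLp 2 (Fin 2 → ℝ)).measurableEmbedding]
  rw [h1, ← integral_comp_polarCoord_symm]
  have h2 : ∀ p : ℝ × ℝ, (WithLp.toLp 2 ((MeasurableEquiv.finTwoArrow (α := ℝ)).symm
      (polarCoord.symm p)) : E2) = p.1 • ev p.2 := by
    intro p
    ext i
    fin_cases i <;> simp [ev, MeasurableEquiv.finTwoArrow]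
  simp only [h2]
  have h3 : (Ioo 0 R ×ˢ Ioo (-π) π : Set (ℝ × ℝ)) = (Ioi 0 ×ˢ Ioo (-π) π) ∩ {p | p.1 < R} := by
    ext p; simp only [mem_prod, mem_Ioo, mem_inter_iff, mem_Ioi, mem_ofPred_eq]; tauto
  rw [h3, ← setIntegral_indicator (measurableSet_lt measurable_fst measurable_const)]
  refine setIntegral_congr_fun (measurableSet_Ioi.prod measurableSet_Ioo) ?_
  rintro p ⟨hp, -⟩
  simp only [mem_Ioi] at hp
  by_cases h : p.1 < R
  · simp [hg, indicator, norm_smul, norm_ev, abs_of_pos hp, h]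
  · simp [hg, indicator, norm_smul, norm_ev, abs_of_pos hp, h]

/-- The radial kernel. -/
def kk (R r : ℝ) : ℝ := Real.log R - Real.log r - (1 - r ^ 2 / R ^ 2) / 2

lemma lap_eq {u : E2 → ℝ} (hu : ContDiff ℝ 2 u) (x : E2) (θ : ℝ) :
    lap u x = fderiv ℝ (fderiv ℝ u) x (ev θ) (ev θ) + fderiv ℝ (fderiv ℝ u) x (ew θ) (ew θ) := by
  have hd : DifferentiableAt ℝ (fderiv ℝ u) x :=
    ((hu.fderiv_right (m := 1) (by norm_num)).differentiable (by norm_num)) x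
  have h : ∀ e : E2, fderiv ℝ (fun y => fderiv ℝ u y e) x e = fderiv ℝ (fderiv ℝ u) x e e := by
    intro e
    rw [fderiv_clm_apply hd (differentiableAt_const e)]
    simp
  unfold lap
  simp only [h, Fin.sum_univ_two]
  unfold ev ew
  simp only [map_add, map_smul, map_neg, neg_smul, add_apply,
    smul_apply, neg_apply, smul_eq_mul]
  have := Real.sin_sq_add_cos_sq θ
  linear_combination (-(fderiv ℝ (fderiv ℝ u) x (EuclideanSpace.single 0 1) (EuclideanSpace.single 0 1))
    - fderiv ℝ (fderiv ℝ u) x (EuclideanSpace.single 1 1) (EuclideanSpace.single 1 1)) * this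

lemma radial_ftc {u : E2 → ℝ} (hu : ContDiff ℝ 2 u) (x0 : E2) {R : ℝ} (hR : 0 < R) (θ : ℝ) :
    ∫ r in (0:ℝ)..R, (kk R r * (fderiv ℝ u (x0 + r • ev θ) (ev θ)
      + r * fderiv ℝ (fderiv ℝ u) (x0 + r • ev θ) (ev θ) (ev θ))
      - 2 * r / R ^ 2 * u (x0 + r • ev θ)) = - u x0 := by
  have hD : ContDiff ℝ 1 (fderiv ℝ u) := hu.fderiv_right (m := 1) (by norm_num)
  have hc0 : Continuous u := hu.continuous
  have hc1 : Continuous (fderiv ℝ u) := hD.continuous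
  have hc2 : Continuous (fderiv ℝ (fderiv ℝ u)) := hD.continuous_fderiv (by norm_num)
  have hP : ∀ r : ℝ, HasDerivAt (fun r : ℝ => x0 + r • ev θ) (ev θ) r := by
    intro r
    simpa using ((hasDerivAt_id r).smul_const (ev θ)).const_add x0
  have h1 : ∀ r : ℝ, HasDerivAt (fun r : ℝ => u (x0 + r • ev θ))
      (fderiv ℝ u (x0 + r • ev θ) (ev θ)) r := fun r =>
    ((hu.differentiable (by norm_num) _).hasFDerivAt).comp_hasDerivAt r (hP r)
  have h2 : ∀ r : ℝ, HasDerivAt (fun r : ℝ => fderiv ℝ u (x0 + r • ev θ) (ev θ))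
      (fderiv ℝ (fderiv ℝ u) (x0 + r • ev θ) (ev θ) (ev θ)) r := fun r => by
    have := ((hD.differentiable (by norm_num) _).hasFDerivAt).comp_hasDerivAt r (hP r)
    simpa using this.clm_apply (hasDerivAt_const r (ev θ))
  set F : ℝ → ℝ := fun r => kk R r * r * fderiv ℝ u (x0 + r • ev θ) (ev θ)
    + (1 - r ^ 2 / R ^ 2) * u (x0 + r • ev θ) with hF
  have hkc : Continuous (fun r => kk R r * r) := by
    have : (fun r => kk R r * r) = fun r => Real.log R * r - r * Real.log r
        - (1 - r ^ 2 / R ^ 2) / 2 * r := by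
      ext r; unfold kk; ring
    rw [this]
    have := Real.continuous_mul_log
    fun_prop
  have hFc : Continuous F := by fun_prop
  have hlog : IntervalIntegrable (kk R) volume 0 R := by
    unfold kk
    refine IntervalIntegrable.sub (IntervalIntegrable.sub (by simp) intervalIntegral.intervalIntegrable_log') ?_
    exact Continuous.intervalIntegrable (by fun_prop) _ _
  rw [intervalIntegral.integral_eq_sub_of_hasDerivAt_of_le (f := F) hR.le hFc.continuousOn]
  · simp only [hF, kk]
    have : R ^ 2 ≠ 0 := by positivity
    simp [this]
  · rintro r ⟨hr, -⟩
    have hk : HasDerivAt (kk R) (-r⁻¹ + r / R ^ 2) r := by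
      unfold kk
      have := ((Real.hasDerivAt_log hr.ne').const_sub (Real.log R)).sub
        ((((hasDerivAt_pow 2 r).div_const (R ^ 2)).const_sub 1).div_const 2)
      refine this.congr_deriv ?_
      simp; ring
    have := ((hk.mul (hasDerivAt_id r)).mul (h2 r)).add
      ((((hasDerivAt_pow 2 r).div_const (R ^ 2)).const_sub 1).mul (h1 r))
    refine this.congr_deriv ?_
    simp
    field_simp
    ring
  · refine IntervalIntegrable.sub (hlog.mul_continuousOn ?_) ?_
    · exact Continuous.continuousOn (by fun_prop)
    · exact Continuous.intervalIntegrable (by fun_prop) _ _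

lemma angular_zero {u : E2 → ℝ} (hu : ContDiff ℝ 2 u) (x0 : E2) (r : ℝ) :
    ∫ θ in (-π)..π, (r * fderiv ℝ (fderiv ℝ u) (x0 + r • ev θ) (ew θ) (ew θ)
      - fderiv ℝ u (x0 + r • ev θ) (ev θ)) = 0 := by
  have hD : ContDiff ℝ 1 (fderiv ℝ u) := hu.fderiv_right (m := 1) (by norm_num)
  have hc1 : Continuous (fderiv ℝ u) := hD.continuous
  have hc2 : Continuous (fderiv ℝ (fderiv ℝ u)) := hD.continuous_fderiv (by norm_num)
  have e1 := continuous_ev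
  have e2 := continuous_ew
  rw [intervalIntegral.integral_eq_sub_of_hasDerivAt
    (f := fun θ => fderiv ℝ u (x0 + r • ev θ) (ew θ))]
  · simp [ev, ew]
  · intro θ _
    have hP : HasDerivAt (fun θ : ℝ => x0 + r • ev θ) (r • ew θ) θ :=
      ((hasDerivAt_ev θ).const_smul r).const_add x0
    have := ((hD.differentiable (by norm_num) _).hasFDerivAt).comp_hasDerivAt θ hP
    have := this.clm_apply (hasDerivAt_ew θ)
    refine this.congr_deriv ?_
    simp; ring
  · exact Continuous.intervalIntegrable (by fun_prop) _ _

lemma integrable_kk_mul {R : ℝ} (hR : 0 < R) {H : ℝ × ℝ → ℝ} (hH : Continuous H) :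
    IntegrableOn (fun p : ℝ × ℝ => kk R p.1 * H p) (Ioo 0 R ×ˢ Ioo (-π) π) := by
  have hlog : IntegrableOn (kk R) (Ioo 0 R) := by
    have : IntervalIntegrable (kk R) volume 0 R := by
      unfold kk
      refine IntervalIntegrable.sub (IntervalIntegrable.sub (by simp) intervalIntegral.intervalIntegrable_log') ?_
      exact Continuous.intervalIntegrable (by fun_prop) _ _
    rw [intervalIntegrable_iff_integrableOn_Ioo_of_le hR.le] at this
    exact this
  have h1 : IntegrableOn (fun p : ℝ × ℝ => kk R p.1) (Ioo 0 R ×ˢ Ioo (-π) π) := by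
    rw [IntegrableOn, Measure.volume_eq_prod, ← Measure.prod_restrict]
    exact Integrable.comp_fst hlog _
  obtain ⟨C, hC⟩ := (isCompact_Icc.prod isCompact_Icc :
    IsCompact (Icc (0:ℝ) R ×ˢ Icc (-π) π)).exists_bound_of_continuousOn hH.continuousOn
  refine Integrable.mul_bdd (c := C) h1 hH.aestronglyMeasurable ?_
  refine (ae_restrict_iff' (measurableSet_Ioo.prod measurableSet_Ioo)).2 (ae_of_all _ ?_)
  rintro p ⟨hp1, hp2⟩
  exact hC p ⟨Ioo_subset_Icc_self hp1, Ioo_subset_Icc_self hp2⟩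

/-- Green type representation in a ball. -/
lemma repr_formula {u : E2 → ℝ} (hu : ContDiff ℝ 2 u) (x0 : E2) {R : ℝ} (hR : 0 < R) :
    2 * π * u x0 = 2 / R ^ 2 * (∫ y in ball x0 R, u y)
      - ∫ y in ball x0 R, kk R ‖y - x0‖ * lap u y := by
  have hD : ContDiff ℝ 1 (fderiv ℝ u) := hu.fderiv_right (m := 1) (by norm_num)
  have hc0 : Continuous u := hu.continuous
  have hc1 : Continuous (fderiv ℝ u) := hD.continuous
  have hc2 : Continuous (fderiv ℝ (fderiv ℝ u)) := hD.continuous_fderiv (by norm_num)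
  have e1 := continuous_ev
  have e2 := continuous_ew
  set S : Set (ℝ × ℝ) := Ioo 0 R ×ˢ Ioo (-π) π with hS
  have hSm : MeasurableSet S := measurableSet_Ioo.prod measurableSet_Ioo
  rw [polar_int, polar_int]
  set A : ℝ × ℝ → ℝ := fun p => fderiv ℝ u (x0 + p.1 • ev p.2) (ev p.2)
      + p.1 * fderiv ℝ (fderiv ℝ u) (x0 + p.1 • ev p.2) (ev p.2) (ev p.2) with hA
  set B : ℝ × ℝ → ℝ := fun p => p.1 * fderiv ℝ (fderiv ℝ u) (x0 + p.1 • ev p.2) (ew p.2) (ew p.2)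
      - fderiv ℝ u (x0 + p.1 • ev p.2) (ev p.2) with hB
  set C : ℝ × ℝ → ℝ := fun p => p.1 * u (x0 + p.1 • ev p.2) with hCdef
  have hAc : Continuous A := by fun_prop
  have hBc : Continuous B := by fun_prop
  have hCc : Continuous C := by fun_prop
  have iA := integrable_kk_mul hR hAc
  have iB := integrable_kk_mul hR hBc
  have iC : IntegrableOn C S :=
    (hCc.continuousOn.integrableOn_compact (isCompact_Icc.prod isCompact_Icc :
      IsCompact (Icc (0:ℝ) R ×ˢ Icc (-π) π))).mono_set
      (prod_mono Ioo_subset_Icc_self Ioo_subset_Icc_self)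
  have hpi : -π ≤ π := by linarith [Real.pi_pos]
  have hB0 : ∫ p in S, kk R p.1 * B p = 0 := by
    rw [hS, Measure.volume_eq_prod, setIntegral_prod _ iB]
    have : ∀ r : ℝ, ∫ θ in Ioo (-π) π, kk R r * B (r, θ) = 0 := by
      intro r
      rw [integral_const_mul, ← integral_Ioc_eq_integral_Ioo,
        ← intervalIntegral.integral_of_le hpi]
      have := angular_zero hu x0 r
      simp only [hB]
      rw [this, mul_zero]
    simp [this]
  have hA0 : ∫ p in S, (kk R p.1 * A p - 2 / R ^ 2 * C p) = - (2 * π * u x0) := by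
    have iAC : IntegrableOn (fun p => kk R p.1 * A p - 2 / R ^ 2 * C p) S :=
      Integrable.sub iA (iC.const_mul _)
    rw [hS, Measure.volume_eq_prod, setIntegral_prod _ iAC, integral_integral_swap]
    · have : ∀ θ : ℝ, ∫ r in Ioo 0 R, (kk R (r, θ).1 * A (r, θ) - 2 / R ^ 2 * C (r, θ)) = - u x0 := by
        intro θ
        rw [← integral_Ioc_eq_integral_Ioo, ← intervalIntegral.integral_of_le hR.le,
          ← radial_ftc hu x0 hR θ]
        congr 1
        ext r
        simp only [hA, hCdef]
        ring
      simp only [this]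
      simp
      rw [max_eq_left (by linarith [Real.pi_pos])]
      ring_nf
      simp
    · rw [Measure.prod_restrict]
      exact iAC
  have hsum : ∫ p in S, p.1 * (kk R ‖x0 + p.1 • ev p.2 - x0‖ * lap u (x0 + p.1 • ev p.2))
      = ∫ p in S, (kk R p.1 * A p + kk R p.1 * B p) := by
    refine setIntegral_congr_fun hSm ?_
    rintro p ⟨hp, -⟩
    have : ‖x0 + p.1 • ev p.2 - x0‖ = p.1 := by
      simp [norm_smul, norm_ev, abs_of_pos hp.1]
    simp only [this, lap_eq hu _ p.2, hA, hB]
    ring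
  rw [hsum, integral_add iA iB, hB0]
  rw [integral_sub iA (iC.const_mul _), integral_const_mul] at hA0
  linarith

lemma lap_congr {u w : E2 → ℝ} {x : E2} (h : u =ᶠ[𝓝 x] w) : lap u x = lap w x := by
  unfold lap
  refine Finset.sum_congr rfl fun i _ => ?_
  have : (fun y => fderiv ℝ u y (EuclideanSpace.single i 1)) =ᶠ[𝓝 x]
      fun y => fderiv ℝ w y (EuclideanSpace.single i 1) := by
    filter_upwards [h.fderiv (𝕜 := ℝ)] with y hy
    rw [hy]
  rw [this.fderiv_eq]

lemma continuousOn_lap {Ω : Set E2} (hΩ : IsOpen Ω) {u : E2 → ℝ} (hu : ContDiffOn ℝ 2 u Ω) :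
    ContinuousOn (lap u) Ω := by
  unfold lap
  refine continuousOn_finsetSum _ fun i _ => ?_
  have h1 : ContDiffOn ℝ 1 (fderiv ℝ u) Ω := hu.fderiv_of_isOpen hΩ (by norm_num)
  have h2 : ContDiffOn ℝ 1 (fun y => fderiv ℝ u y (EuclideanSpace.single i 1)) Ω :=
    h1.clm_apply contDiffOn_const
  exact (h2.continuousOn_fderiv_of_isOpen hΩ (by norm_num)).clm_apply continuousOn_const

lemma repr_local {Ω : Set E2} (hΩ : IsOpen Ω) {u : E2 → ℝ} (hu : ContDiffOn ℝ 2 u Ω)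
    (x0 : E2) {R : ℝ} (hR : 0 < R) (hsub : closedBall x0 R ⊆ Ω) :
    2 * π * u x0 = 2 / R ^ 2 * (∫ y in ball x0 R, u y)
      + ∫ y in ball x0 R, kk R ‖y - x0‖ * (-lap u y) := by
  obtain ⟨δ, hδ, hδΩ⟩ := (isCompact_closedBall x0 R).exists_cthickening_subset_open hΩ hsub
  rw [cthickening_closedBall hδ.le hR.le] at hδΩ
  let χ : ContDiffBump x0 := ⟨R + δ / 3, R + δ / 2, by positivity, by linarith⟩
  set w : E2 → ℝ := fun y => χ y * u y with hw
  have hwc : ContDiff ℝ 2 w := by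
    rw [contDiff_iff_contDiffAt]
    intro x
    by_cases hx : x ∈ Ω
    · exact χ.contDiffAt.mul (hu.contDiffAt (hΩ.mem_nhds hx))
    · have hx' : x ∈ (closedBall x0 (R + δ / 2))ᶜ := fun h => hx (hδΩ (closedBall_subset_closedBall (by linarith) h))
      have : w =ᶠ[𝓝 x] fun _ => 0 := by
        filter_upwards [isClosed_closedBall.isOpen_compl.mem_nhds hx'] with y hy
        have : χ y = 0 := χ.zero_of_le_dist (by
          simp only [mem_compl_iff, mem_closedBall, not_le] at hy
          exact hy.le)
        simp [hw, this]
      exact contDiffAt_const.congr_of_eventuallyEq this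
  have heq : ∀ y ∈ ball x0 (R + δ / 3), w y = u y := by
    intro y hy
    have : χ y = 1 := χ.one_of_mem_closedBall (ball_subset_closedBall hy)
    simp [hw, this]
  have hb : ball x0 R ⊆ ball x0 (R + δ / 3) := ball_subset_ball (by linarith)
  have hlap : ∀ y ∈ ball x0 R, lap w y = lap u y := fun y hy =>
    lap_congr (by filter_upwards [isOpen_ball.mem_nhds (hb hy)] with z hz using heq z hz)
  have := repr_formula hwc x0 hR
  have e1 : ∫ y in ball x0 R, kk R ‖y - x0‖ * lap w y = ∫ y in ball x0 R, kk R ‖y - x0‖ * lap u y :=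
    setIntegral_congr_fun measurableSet_ball (fun y hy => by simp only [hlap y hy])
  rw [heq x0 (mem_ball_self (by positivity)), e1,
    setIntegral_congr_fun measurableSet_ball (fun y hy => heq y (hb hy))] at this
  rw [this]
  simp only [mul_neg, integral_neg]
  ring

lemma kk_nonneg {R r : ℝ} (hr : 0 < r) (hrR : r ≤ R) : 0 ≤ kk R r := by
  have hR : 0 < R := hr.trans_le hrR
  unfold kk
  have h := Real.log_le_sub_one_of_pos (show 0 < r ^ 2 / R ^ 2 by positivity)
  rw [Real.log_div (by positivity) (by positivity), Real.log_pow, Real.log_pow] at h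
  push_cast at h
  linarith

lemma kk_le {R r : ℝ} (hr : 0 < r) (hrR : r ≤ R) : kk R r ≤ Real.log R - Real.log r := by
  have hR : 0 < R := hr.trans_le hrR
  unfold kk
  have : r ^ 2 / R ^ 2 ≤ 1 := by
    rw [div_le_one (by positivity)]; gcongr
  linarith

lemma le_kk {R r : ℝ} : Real.log R - Real.log r - 1 / 2 ≤ kk R r := by
  unfold kk
  have : 0 ≤ r ^ 2 / R ^ 2 := by positivity
  linarith

lemma integrableOn_radial {φ : ℝ → ℝ} {r : ℝ} (h : IntegrableOn (fun y => y * φ y) (Ioo 0 r))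
    (x0 : E2) : IntegrableOn (fun y : E2 => φ ‖y - x0‖) (ball x0 r) := by
  have h1 : IntegrableOn (fun y : E2 => φ ‖y‖) (ball 0 r) := by
    rw [integrableOn_fun_norm_addHaar]
    simpa using h
  rw [← integrable_indicator_iff measurableSet_ball] at h1 ⊢
  have := h1.comp_sub_right x0
  refine this.congr (ae_of_all _ fun y => ?_)
  simp [indicator, dist_eq_norm]

lemma integrableOn_log (x0 : E2) (r : ℝ) :
    IntegrableOn (fun y : E2 => Real.log ‖y - x0‖) (ball x0 r) := by
  refine integrableOn_radial (φ := Real.log) ?_ x0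
  exact (Real.continuous_mul_log.continuousOn.integrableOn_compact isCompact_Icc).mono_set
    Ioo_subset_Icc_self

lemma integrableOn_kk (x0 : E2) (R : ℝ) :
    IntegrableOn (fun y : E2 => kk R ‖y - x0‖) (ball x0 R) := by
  refine integrableOn_radial ?_ x0
  have : (fun r => r * kk R r) = fun r => Real.log R * r - r * Real.log r
        - (1 - r ^ 2 / R ^ 2) / 2 * r := by
      ext r; unfold kk; ring
  rw [this]
  have := Real.continuous_mul_log
  have hc : Continuous fun r => Real.log R * r - r * Real.log r
        - (1 - r ^ 2 / R ^ 2) / 2 * r := by fun_prop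
  exact (hc.continuousOn.integrableOn_compact isCompact_Icc).mono_set Ioo_subset_Icc_self

lemma integrableOn_mul_cont {s t : Set E2} (hs : MeasurableSet s) (hst : s ⊆ t) (ht : IsCompact t) {φ h : E2 → ℝ}
    (hφ : IntegrableOn φ s) (hh : ContinuousOn h t) : IntegrableOn (fun y => φ y * h y) s := by
  obtain ⟨C, hC⟩ := ht.exists_bound_of_continuousOn hh
  refine Integrable.mul_bdd (c := C) hφ ((hh.mono hst).aestronglyMeasurable hs) ?_
  exact (ae_restrict_iff' hs).2 (ae_of_all _ fun y hy => hC y (hst hy))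

/-- Nonnegative `C²` supersolutions with bounded exponential energy. -/
structure Good (Ω : Set E2) (u : E2 → ℝ) (C : ℝ) : Prop where
  smooth : ContDiffOn ℝ 2 u Ω
  super : ∀ x ∈ Ω, 0 ≤ -lap u x
  nonneg : ∀ x ∈ Ω, 0 ≤ u x
  int : IntegrableOn (fun x => Real.exp (u x)) Ω
  energy : ∫ x in Ω, Real.exp (u x) ≤ C

lemma ae_ne_restrict (x0 : E2) (s : Set E2) : ∀ᵐ y ∂(volume.restrict s), y ≠ x0 :=
  ae_restrict_of_ae (by
    have : volume ({x0} : Set E2) = 0 := measure_singleton x0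
    exact compl_mem_ae_iff.2 this)

/-- superharmonic mean value inequality -/
lemma mean_le {Ω : Set E2} (hΩ : IsOpen Ω) {u : E2 → ℝ} (hu : ContDiffOn ℝ 2 u Ω)
    (hs : ∀ x ∈ Ω, 0 ≤ -lap u x)
    (x0 : E2) {R : ℝ} (hR : 0 < R) (hsub : closedBall x0 R ⊆ Ω) :
    2 / R ^ 2 * (∫ y in ball x0 R, u y) ≤ 2 * π * u x0 := by
  rw [repr_local hΩ hu x0 hR hsub]
  refine le_add_of_nonneg_right (integral_nonneg_of_ae ?_)
  filter_upwards [ae_ne_restrict x0 (ball x0 R), ae_restrict_mem measurableSet_ball] with y hy hyB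
  have h1 : 0 < ‖y - x0‖ := norm_pos_iff.2 (sub_ne_zero.2 hy)
  have h2 : ‖y - x0‖ ≤ R := by rw [← dist_eq_norm]; exact (mem_ball.1 hyB).le
  exact mul_nonneg (kk_nonneg h1 h2) (hs y (hsub (ball_subset_closedBall hyB)))

lemma nonneg_of_super {Ω : Set E2} (hΩ : IsOpen Ω) (hb : Bornology.IsBounded Ω) {u : E2 → ℝ}
    (hu : ContDiffOn ℝ 2 u (closure Ω)) (hs : ∀ x ∈ Ω, 0 ≤ -lap u x)
    (h0 : ∀ x ∈ frontier Ω, u x = 0) : ∀ x ∈ Ω, 0 ≤ u x := by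
  intro z hz
  have hK : IsCompact (closure Ω) := hb.isCompact_closure
  have huc : ContinuousOn u (closure Ω) := hu.continuousOn
  obtain ⟨a, ha, hmin⟩ := hK.exists_isMinOn ⟨z, subset_closure hz⟩ huc
  have hmin' : ∀ y ∈ closure Ω, u a ≤ u y := fun y hy => hmin hy
  by_contra! hneg
  have hm : u a < 0 := (hmin' z (subset_closure hz)).trans_lt hneg
  set S : Set E2 := {x ∈ closure Ω | u x = u a} with hS
  have hSΩ : S ⊆ Ω := by
    rintro x ⟨hx, hxa⟩
    by_contra hxΩ
    have : x ∈ frontier Ω := ⟨hx, by rwa [hΩ.interior_eq]⟩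
    rw [h0 x this] at hxa
    linarith
  have hclosed : IsClosed S := by
    have := huc.preimage_isClosed_of_isClosed hK.isClosed (isClosed_singleton (x := u a))
    exact this
  have hopen : IsOpen S := by
    rw [isOpen_iff_mem_nhds]
    intro x hx
    obtain ⟨R, hR, hRΩ⟩ := nhds_basis_closedBall.mem_iff.1 (hΩ.mem_nhds (hSΩ hx))
    refine mem_of_superset (ball_mem_nhds x hR) ?_
    have hsubc : closedBall x R ⊆ closure Ω := hRΩ.trans subset_closure
    have hmean := mean_le hΩ (hu.mono subset_closure) hs x hR hRΩ
    have hint : IntegrableOn u (ball x R) :=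
      ((huc.mono hsubc).integrableOn_compact (isCompact_closedBall x R)).mono_set
        ball_subset_closedBall
    have hfin : IntegrableOn (fun _ => u a) (ball x R) := integrableOn_const measure_ball_lt_top.ne
    have hz0 : ∫ y in ball x R, (u y - u a) = 0 := by
      apply le_antisymm
      · rw [integral_sub hint hfin, setIntegral_const, hx.2] at *
        have hv : volume.real (ball x R) = π * R ^ 2 := by
          rw [Measure.real, EuclideanSpace.volume_ball_fin_two]
          simp [hR.le, Real.pi_pos.le]
          ring
        rw [hv, smul_eq_mul]
        rw [div_mul_eq_mul_div, div_le_iff₀ (by positivity)] at hmean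
        linarith
      · exact setIntegral_nonneg measurableSet_ball fun y hy =>
          sub_nonneg.2 (hmin' y (hsubc (ball_subset_closedBall hy)))
    have hae := (setIntegral_eq_zero_iff_of_nonneg_ae (by
      filter_upwards [ae_restrict_mem measurableSet_ball] with y hy
      exact sub_nonneg.2 (hmin' y (hsubc (ball_subset_closedBall hy)))) (hint.sub hfin)).1 hz0
    have heq : EqOn (fun y => u y - u a) 0 (ball x R) :=
      Measure.eqOn_open_of_ae_eq hae isOpen_ball
        (((huc.mono hsubc).mono ball_subset_closedBall).sub continuousOn_const) continuousOn_const
    intro y hy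
    exact ⟨hsubc (ball_subset_closedBall hy), sub_eq_zero.1 (heq hy)⟩
  have huniv : S = univ := IsClopen.eq_univ ⟨hclosed, hopen⟩ ⟨a, ha, rfl⟩
  have : Bornology.IsBounded (univ : Set E2) := by
    rw [← huniv]; exact hb.subset hSΩ
  exact NoncompactSpace.noncompact_univ (X := E2)
    (Metric.isCompact_of_isClosed_isBounded isClosed_univ this)

lemma Good.mono_C {Ω : Set E2} {u : E2 → ℝ} {C C' : ℝ} (h : Good Ω u C) (hC : C ≤ C') :
    Good Ω u C' := ⟨h.smooth, h.super, h.nonneg, h.int, h.energy.trans hC⟩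

lemma Good.energy_sub {Ω : Set E2} {u : E2 → ℝ} {C : ℝ} (h : Good Ω u C) {s : Set E2}
    (hsΩ : s ⊆ Ω) : ∫ x in s, Real.exp (u x) ≤ C :=
  (setIntegral_mono_set h.int (ae_of_all _ fun _ => (Real.exp_pos _).le) hsΩ.eventuallyLE).trans h.energy

/-- upper bound -/
lemma Good.upper {Ω : Set E2} {u : E2 → ℝ} {C : ℝ} (hΩ : IsOpen Ω) (h : Good Ω u C)
    (x0 : E2) {R : ℝ} (hR : 0 < R) (hsub : closedBall x0 R ⊆ Ω) :
    2 * π * u x0 ≤ 2 / R ^ 2 * C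
      + ∫ y in ball x0 R, (Real.log R - Real.log ‖y - x0‖) * (-lap u y) := by
  rw [repr_local hΩ h.smooth x0 hR hsub]
  have hbs : ball x0 R ⊆ Ω := ball_subset_closedBall.trans hsub
  have hlc : ContinuousOn (fun y => -lap u y) (closedBall x0 R) :=
    ((continuousOn_lap hΩ h.smooth).mono hsub).neg
  have huint : IntegrableOn u (ball x0 R) :=
      ((h.smooth.continuousOn.mono hsub).integrableOn_compact (isCompact_closedBall x0 R)).mono_set
        ball_subset_closedBall
  refine add_le_add (mul_le_mul_of_nonneg_left ?_ (by positivity)) ?_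
  · refine le_trans ?_ (h.energy_sub hbs)
    refine integral_mono huint (h.int.mono_set hbs) fun y => ?_
    have := Real.add_one_le_exp (u y)
    dsimp only
    linarith
  · refine integral_mono_ae
      (integrableOn_mul_cont measurableSet_ball ball_subset_closedBall (isCompact_closedBall x0 R)
        (integrableOn_kk x0 R) hlc)
      (integrableOn_mul_cont measurableSet_ball ball_subset_closedBall (isCompact_closedBall x0 R)
        (Integrable.sub (integrableOn_const measure_ball_lt_top.ne) (integrableOn_log x0 R)) hlc) ?_
    filter_upwards [ae_ne_restrict x0 (ball x0 R), ae_restrict_mem measurableSet_ball] with y hy hyB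
    have h1 : 0 < ‖y - x0‖ := norm_pos_iff.2 (sub_ne_zero.2 hy)
    have h2 : ‖y - x0‖ ≤ R := by rw [← dist_eq_norm]; exact (mem_ball.1 hyB).le
    exact mul_le_mul_of_nonneg_right (kk_le h1 h2) (h.super y (hbs hyB))

lemma measurableSet_annulus (x0 : E2) (ε r : ℝ) :
    MeasurableSet {x : E2 | ε < ‖x - x0‖ ∧ ‖x - x0‖ < r} := by
  have h : Measurable fun x : E2 => ‖x - x0‖ := by fun_prop
  exact h measurableSet_Ioo

lemma annulus_integral (x0 : E2) {ε r η : ℝ} (hε : 0 < ε) (hεr : ε < r) (hη : 0 < η) :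
    IntegrableOn (fun x : E2 => (r / ‖x - x0‖) ^ (2 - η)) {x | ε < ‖x - x0‖ ∧ ‖x - x0‖ < r} ∧
    ∫ x in {x : E2 | ε < ‖x - x0‖ ∧ ‖x - x0‖ < r}, (r / ‖x - x0‖) ^ (2 - η)
      = 2 * π * (r ^ 2 * (1 - (ε / r) ^ η) / η) := by
  have hr : 0 < r := hε.trans hεr
  have hmeas : MeasurableSet {x : E2 | ε < ‖x - x0‖ ∧ ‖x - x0‖ < r} :=
    measurableSet_annulus x0 ε r
  set g : ℝ → ℝ := (Ioo ε r).indicator (fun s => (r / s) ^ (2 - η)) with hg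
  have hind : ({x : E2 | ε < ‖x - x0‖ ∧ ‖x - x0‖ < r}).indicator
      (fun x : E2 => (r / ‖x - x0‖) ^ (2 - η)) = fun x => g ‖x - x0‖ := by
    ext x
    simp [hg, indicator]
  have hrad : ∀ y : ℝ, y ^ (Module.finrank ℝ E2 - 1) • g y
      = (Ioo ε r).indicator (fun s => r ^ (2 - η) * s ^ (η - 1)) y := by
    intro y
    by_cases hy : y ∈ Ioo ε r
    · have hy0 : 0 < y := hε.trans hy.1
      simp only [hg, indicator_of_mem hy]
      simp only [finrank_euclideanSpace, Fintype.card_fin, Nat.add_one_sub_one, pow_one, smul_eq_mul]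
      rw [Real.div_rpow hr.le hy0.le, show η - 1 = 1 - (2 - η) by ring, Real.rpow_sub hy0 1, Real.rpow_one]
      ring
    · simp [hg, indicator_of_notMem hy]
  have hc : ContinuousOn (fun s : ℝ => r ^ (2 - η) * s ^ (η - 1)) (Icc ε r) := by
    refine continuousOn_const.mul (ContinuousOn.rpow_const continuousOn_id fun x hx => Or.inl ?_)
    exact (hε.trans_le hx.1).ne'
  constructor
  · rw [← integrable_indicator_iff hmeas, hind]
    refine Integrable.comp_sub_right (f := fun x : E2 => g ‖x‖) ?_ x0
    rw [integrable_fun_norm_addHaar]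
    simp only [hrad]
    refine Integrable.integrableOn ?_
    rw [integrable_indicator_iff measurableSet_Ioo]
    exact (hc.integrableOn_compact isCompact_Icc).mono_set Ioo_subset_Icc_self
  · rw [← integral_indicator hmeas, hind, integral_sub_right_eq_self (fun x : E2 => g ‖x‖) x0,
      integral_fun_norm_addHaar]
    simp only [hrad]
    have hv : volume.real (ball (0:E2) 1) = π := by
      rw [Measure.real, EuclideanSpace.volume_ball_fin_two]
      simp [Real.pi_pos.le]
    rw [hv, setIntegral_indicator measurableSet_Ioo,
      inter_eq_right.2 (Ioo_subset_Ioi_self.trans (Ioi_subset_Ioi hε.le)),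
      ← integral_Ioc_eq_integral_Ioo, ← intervalIntegral.integral_of_le hεr.le,
      intervalIntegral.integral_const_mul, integral_rpow (Or.inl (by linarith))]
    simp only [finrank_euclideanSpace, Fintype.card_fin, smul_eq_mul, nsmul_eq_mul, sub_add_cancel]
    have h1 : r ^ (2 - η) * r ^ η = r ^ 2 := by
      rw [← Real.rpow_add hr]; simp
    have h2 : ε ^ η = (ε / r) ^ η * r ^ η := by
      rw [← Real.mul_rpow (by positivity) hr.le, div_mul_cancel₀ _ hr.ne']
    rw [h2, ← h1]
    push_cast
    ring

lemma Good.lower {Ω : Set E2} {u : E2 → ℝ} {C : ℝ} (hΩ : IsOpen Ω) (h : Good Ω u C)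
    {x0 x : E2} {R ε : ℝ} (hR : 0 < R) (hε : 0 < ε) (hsub : closedBall x0 (2 * R) ⊆ Ω)
    (h1 : ε < ‖x - x0‖) (h2 : ‖x - x0‖ < R * Real.exp (-1/2) / 2) :
    (∫ y in ball x0 ε, -lap u y) * Real.log (R * Real.exp (-1/2) / 2 / ‖x - x0‖) ≤ 2 * π * u x := by
  set s := ‖x - x0‖ with hs
  have hs0 : 0 < s := hε.trans h1
  have he : Real.exp (-1/2) ≤ 1 := Real.exp_le_one_iff.2 (by norm_num)
  have h2s : 2 * s < R := by nlinarith
  have hd : dist x x0 = s := dist_eq_norm x x0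
  have hsubx : closedBall x R ⊆ Ω := (closedBall_subset_closedBall' (by linarith)).trans hsub
  have hbb : ball x0 ε ⊆ ball x R := ball_subset_ball' (by rw [dist_comm]; linarith)
  have hlc : ContinuousOn (fun y => -lap u y) (closedBall x R) :=
    ((continuousOn_lap hΩ h.smooth).mono hsubx).neg
  have hint := integrableOn_mul_cont measurableSet_ball ball_subset_closedBall (isCompact_closedBall x R)
        (integrableOn_kk x R) hlc
  have hint2 : IntegrableOn (fun y => -lap u y) (ball x0 ε) :=
    ((hlc.integrableOn_compact (isCompact_closedBall x R)).mono_set ball_subset_closedBall).mono_set hbb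
  rw [repr_local hΩ h.smooth x hR hsubx]
  have hu0 : 0 ≤ 2 / R ^ 2 * ∫ y in ball x R, u y :=
    mul_nonneg (by positivity) (setIntegral_nonneg measurableSet_ball fun y hy =>
      h.nonneg y (hsubx (ball_subset_closedBall hy)))
  refine le_trans ?_ (le_add_of_nonneg_left hu0)
  calc _ = ∫ y in ball x0 ε, Real.log (R * Real.exp (-1/2) / 2 / s) * (-lap u y) := by
        rw [integral_const_mul, mul_comm]
    _ ≤ ∫ y in ball x0 ε, kk R ‖y - x‖ * (-lap u y) := by
        refine setIntegral_mono_on (hint2.const_mul _) (hint.mono_set hbb) measurableSet_ball fun y hy => ?_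
        have hy' : ‖y - x0‖ < ε := by rwa [← dist_eq_norm]
        have hle : ‖y - x‖ ≤ 2 * s := by
          have : y - x = (y - x0) - (x - x0) := by abel
          rw [this]
          linarith [norm_sub_le (y - x0) (x - x0)]
        have hpos : 0 < ‖y - x‖ := by
          have : x - x0 = (y - x0) - (y - x) := by abel
          have := norm_sub_le (y - x0) (y - x)
          rw [← ‹x - x0 = (y - x0) - (y - x)›] at this
          linarith
        refine mul_le_mul_of_nonneg_right (le_trans ?_ le_kk)
          (h.super y (hsubx (ball_subset_closedBall (hbb hy))))
        have := Real.log_le_log hpos hle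
        rw [Real.log_mul (by norm_num) hs0.ne'] at this
        rw [Real.log_div (by positivity) hs0.ne', Real.log_div (by positivity) (by norm_num),
          Real.log_mul hR.ne' (Real.exp_pos _).ne', Real.log_exp]
        linarith
    _ ≤ _ := by
        refine setIntegral_mono_set hint ?_ hbb.eventuallyLE
        filter_upwards [ae_ne_restrict x (ball x R), ae_restrict_mem measurableSet_ball] with y hy hyB
        have h1 : 0 < ‖y - x‖ := norm_pos_iff.2 (sub_ne_zero.2 hy)
        have h2 : ‖y - x‖ ≤ R := by rw [← dist_eq_norm]; exact (mem_ball.1 hyB).le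
        exact mul_nonneg (kk_nonneg h1 h2) (h.super y (hsubx (ball_subset_closedBall hyB)))

lemma mass_bound {R : ℝ} (hR : 0 < R) (C : ℝ) : ∃ η ε : ℝ, 0 < η ∧ η < 1 ∧ 0 < ε ∧ ε < R ∧
    ∀ (Ω : Set E2) (u : E2 → ℝ) (x0 : E2), IsOpen Ω → Good Ω u C → closedBall x0 (2 * R) ⊆ Ω →
      ∫ y in ball x0 ε, -lap u y ≤ 2 * π * (2 - η) := by
  set r : ℝ := R * Real.exp (-1/2) / 2 with hr
  have hr0 : 0 < r := by positivity
  have he : Real.exp (-1/2) ≤ 1 := Real.exp_le_one_iff.2 (by norm_num)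
  have hrR : r < R := by nlinarith
  have hpi := Real.pi_pos
  obtain ⟨η, hη0, hη1, hη⟩ : ∃ η : ℝ, 0 < η ∧ η < 1 ∧ C < π * r ^ 2 / η := by
    refine ⟨min (1 / 2) (π * r ^ 2 / (|C| + 1)), by positivity, (min_le_left _ _).trans_lt (by norm_num), ?_⟩
    have hpos : 0 < min (1 / 2) (π * r ^ 2 / (|C| + 1)) := by positivity
    rw [lt_div_iff₀ hpos]
    have h1 : |C| * min (1 / 2) (π * r ^ 2 / (|C| + 1)) ≤ |C| * (π * r ^ 2 / (|C| + 1)) := by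
      gcongr; exact min_le_right _ _
    have h2 : |C| * (π * r ^ 2 / (|C| + 1)) < π * r ^ 2 := by
      rw [mul_div_assoc', div_lt_iff₀ (by positivity)]
      nlinarith [show 0 < π * r ^ 2 by positivity]
    have h3 : C * min (1 / 2) (π * r ^ 2 / (|C| + 1)) ≤ |C| * min (1 / 2) (π * r ^ 2 / (|C| + 1)) := by
      gcongr; exact le_abs_self C
    linarith
  have hε1 : (1 / 2 : ℝ) ^ (1 / η) < 1 :=
    Real.rpow_lt_one (by norm_num) (by norm_num) (by positivity)
  set ε : ℝ := r * (1 / 2 : ℝ) ^ (1 / η) with hε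
  have hε0 : 0 < ε := by positivity
  have hεr : ε < r := by nlinarith
  refine ⟨η, ε, hη0, hη1, hε0, hεr.trans hrR, ?_⟩
  intro Ω u x0 hΩ h hsub
  by_contra! hm
  obtain ⟨hi, hI⟩ := annulus_integral x0 hε0 hεr hη0
  set S : Set E2 := {x : E2 | ε < ‖x - x0‖ ∧ ‖x - x0‖ < r} with hS
  have hSm : MeasurableSet S :=
    measurableSet_annulus x0 ε r
  have hSΩ : S ⊆ Ω := by
    intro x hx
    refine hsub ?_
    rw [mem_closedBall, dist_eq_norm]
    linarith [hx.2]
  have hle : ∫ x in S, (r / ‖x - x0‖) ^ (2 - η) ≤ ∫ x in S, Real.exp (u x) := by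
    refine setIntegral_mono_on hi (h.int.mono_set hSΩ) hSm fun x hx => ?_
    have hx0 : 0 < ‖x - x0‖ := hε0.trans hx.1
    rw [Real.rpow_def_of_pos (by positivity)]
    apply Real.exp_le_exp.2
    have hl := h.lower hΩ hR hε0 hsub hx.1 hx.2
    rw [← hr] at hl
    have hlog : 0 ≤ Real.log (r / ‖x - x0‖) := Real.log_nonneg (by rw [le_div_iff₀ hx0]; linarith [hx.2])
    have := mul_le_mul_of_nonneg_right hm.le hlog
    have h3 : 2 * π * (Real.log (r / ‖x - x0‖) * (2 - η)) ≤ 2 * π * u x := by linarith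
    exact le_of_mul_le_mul_left h3 (by positivity)
  have hfin := hle.trans (h.energy_sub hSΩ)
  rw [hI] at hfin
  have hhalf : (ε / r) ^ η = 1 / 2 := by
    rw [hε, mul_div_cancel_left₀ _ hr0.ne', ← Real.rpow_mul (by norm_num), one_div_mul_cancel hη0.ne',
      Real.rpow_one]
  rw [hhalf] at hfin
  have : 2 * π * (r ^ 2 * (1 - 1 / 2) / η) = π * r ^ 2 / η := by ring
  linarith

lemma Good.upper2 {Ω : Set E2} {u : E2 → ℝ} {C : ℝ} (hΩ : IsOpen Ω) (h : Good Ω u C)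
    {x0 x : E2} {ε : ℝ} (hε : 0 < ε) (hsub : closedBall x0 ε ⊆ Ω) (hx : x ∈ ball x0 (ε / 2)) :
    IntegrableOn (fun y => (Real.log (2 * ε) - Real.log ‖y - x‖) * (-lap u y)) (ball x0 ε) ∧
    2 * π * u x ≤ 8 / ε ^ 2 * C
      + ∫ y in ball x0 ε, (Real.log (2 * ε) - Real.log ‖y - x‖) * (-lap u y) := by
  rw [mem_ball] at hx
  have hsub1 : closedBall x (ε / 2) ⊆ closedBall x0 ε := closedBall_subset_closedBall' (by linarith)
  have hb1 : ball x (ε / 2) ⊆ ball x0 ε := ball_subset_ball' (by linarith)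
  have hb2 : ball x0 ε ⊆ ball x (2 * ε) := ball_subset_ball' (by rw [dist_comm]; linarith)
  have hlc : ContinuousOn (fun y => -lap u y) (closedBall x0 ε) :=
    ((continuousOn_lap hΩ h.smooth).mono hsub).neg
  have hint : IntegrableOn (fun y => (Real.log (2 * ε) - Real.log ‖y - x‖) * (-lap u y)) (ball x0 ε) :=
    integrableOn_mul_cont measurableSet_ball ball_subset_closedBall (isCompact_closedBall x0 ε)
        (Integrable.sub (integrableOn_const measure_ball_lt_top.ne)
          ((integrableOn_log x (2 * ε)).mono_set hb2)) hlc
  have hint1 : IntegrableOn (fun y => (Real.log (ε / 2) - Real.log ‖y - x‖) * (-lap u y)) (ball x (ε / 2)) :=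
    integrableOn_mul_cont measurableSet_ball ball_subset_closedBall (isCompact_closedBall x (ε / 2))
        (Integrable.sub (integrableOn_const measure_ball_lt_top.ne)
          (integrableOn_log x (ε / 2))) (hlc.mono hsub1)
  refine ⟨hint, (h.upper hΩ x (half_pos hε) (hsub1.trans hsub)).trans (add_le_add (le_of_eq (by field_simp; ring)) ?_)⟩
  refine le_trans (b := ∫ y in ball x (ε / 2), (Real.log (2 * ε) - Real.log ‖y - x‖) * (-lap u y)) ?_ ?_
  · refine setIntegral_mono_on hint1 (hint.mono_set hb1) measurableSet_ball fun y hy => ?_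
    refine mul_le_mul_of_nonneg_right ?_ (h.super y (hsub (ball_subset_closedBall (hb1 hy))))
    have := Real.log_le_log (half_pos hε) (show ε / 2 ≤ 2 * ε by linarith)
    linarith
  · refine setIntegral_mono_set hint ?_ hb1.eventuallyLE
    filter_upwards [ae_ne_restrict x (ball x0 ε), ae_restrict_mem measurableSet_ball] with y hy hyB
    have h1 : 0 < ‖y - x‖ := norm_pos_iff.2 (sub_ne_zero.2 hy)
    have h2 : ‖y - x‖ ≤ 2 * ε := by rw [← dist_eq_norm]; exact (mem_ball.1 (hb2 hyB)).le
    exact mul_nonneg (sub_nonneg.2 (Real.log_le_log h1 h2)) (h.super y (hsub (ball_subset_closedBall hyB)))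

lemma jensen_exp {α : Type*} [MeasurableSpace α] {μ : Measure α} {L h : α → ℝ}
    (hh : ∀ᵐ x ∂μ, 0 ≤ h x) (ih : Integrable h μ) (iL : Integrable (fun x => L x * h x) μ)
    (ie : Integrable (fun x => Real.exp (L x) * h x) μ) (h1 : ∫ x, h x ∂μ ≤ 1) :
    Real.exp (∫ x, L x * h x ∂μ) ≤ 1 + ∫ x, Real.exp (L x) * h x ∂μ := by
  set T := ∫ x, L x * h x ∂μ with hT
  set N := ∫ x, h x ∂μ with hN
  have hN0 : 0 ≤ N := integral_nonneg_of_ae hh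
  have hlow : Real.exp T * ((1 - T) * N + T) ≤ ∫ x, Real.exp (L x) * h x ∂μ := by
    have : Real.exp T * ((1 - T) * N + T) = ∫ x, Real.exp T * ((1 - T) * h x + L x * h x) ∂μ := by
      rw [integral_const_mul, integral_add (ih.const_mul _) iL, integral_const_mul]
    rw [this]
    refine integral_mono_ae (((ih.const_mul _).add iL).const_mul _) ie ?_
    filter_upwards [hh] with x hx
    have h2 := Real.add_one_le_exp (L x - T)
    have h3 : Real.exp (L x) = Real.exp T * Real.exp (L x - T) := by
      rw [← Real.exp_add]; congr 1; ring
    have h4 : Real.exp T * (1 - T + L x) ≤ Real.exp (L x) := by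
      rw [h3]; gcongr; linarith
    calc _ = Real.exp T * (1 - T + L x) * h x := by ring
      _ ≤ _ := mul_le_mul_of_nonneg_right h4 hx
  have h5 : 0 ≤ 1 + T * Real.exp T - Real.exp T := by
    have h6 := Real.add_one_le_exp (-T)
    have h7 : Real.exp T * Real.exp (-T) = 1 := by rw [← Real.exp_add]; simp
    nlinarith [Real.exp_pos T]
  nlinarith [mul_nonneg (sub_nonneg.2 h1) h5]

lemma integrableOn_pk {a : ℝ} (ha : a < 2) (D : ℝ) (x : E2) (r : ℝ) :
    IntegrableOn (fun y : E2 => Real.exp (a * (Real.log D - Real.log ‖y - x‖))) (ball x r) := by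
  rcases le_or_gt r 0 with hr | hr
  · simp [ball_eq_empty.2 hr]
  refine integrableOn_radial (φ := fun s => Real.exp (a * (Real.log D - Real.log s))) ?_ x
  have h1 : IntegrableOn (fun s : ℝ => Real.exp (a * Real.log D) * s ^ (1 - a)) (Ioo 0 r) := by
    have := intervalIntegral.intervalIntegrable_rpow' (a := 0) (b := r) (r := 1 - a) (by linarith)
    rw [intervalIntegrable_iff_integrableOn_Ioo_of_le hr.le] at this
    exact this.const_mul _
  refine h1.congr_fun (fun s hs => ?_) measurableSet_Ioo
  dsimp only
  rw [Real.rpow_def_of_pos hs.1]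
  nth_rewrite 2 [← Real.exp_log hs.1]
  rw [← Real.exp_add, ← Real.exp_add]
  congr 1; ring

lemma Good.exp_upper {Ω : Set E2} {v : E2 → ℝ} {C : ℝ} (hΩ : IsOpen Ω) (h : Good Ω v C)
    {x0 x : E2} {ε p : ℝ} (hε : 0 < ε) (hsub : closedBall x0 ε ⊆ Ω) (hx : x ∈ ball x0 (ε / 2))
    (hp : 0 < p) (hp2 : p < 2) (hm : ∫ y in ball x0 ε, -lap v y ≤ 2 * π * p) :
    Real.exp (v x) ≤ Real.exp (8 / ε ^ 2 * C / (2 * π)) * (1 + 1 / (2 * π * p) *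
      ∫ z in ball x0 ε, Real.exp (p * (Real.log (2 * ε) - Real.log ‖z - x‖)) * (-lap v z)) := by
  obtain ⟨hi, hle⟩ := h.upper2 hΩ hε hsub hx
  have hpi := Real.pi_pos
  have hb2 : ball x0 ε ⊆ ball x (2 * ε) := ball_subset_ball' (by
    rw [mem_ball] at hx; rw [dist_comm]; linarith)
  have hlc : ContinuousOn (fun y => -lap v y) (closedBall x0 ε) :=
    ((continuousOn_lap hΩ h.smooth).mono hsub).neg
  have ig : IntegrableOn (fun y => -lap v y) (ball x0 ε) :=
    (hlc.integrableOn_compact (isCompact_closedBall x0 ε)).mono_set ball_subset_closedBall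
  have ie : IntegrableOn (fun z => Real.exp (p * (Real.log (2 * ε) - Real.log ‖z - x‖)) * (-lap v z))
      (ball x0 ε) :=
    integrableOn_mul_cont measurableSet_ball ball_subset_closedBall (isCompact_closedBall x0 ε)
      ((integrableOn_pk hp2 (2 * ε) x (2 * ε)).mono_set hb2) hlc
  have hJ := jensen_exp (μ := volume.restrict (ball x0 ε))
    (L := fun z => p * (Real.log (2 * ε) - Real.log ‖z - x‖)) (h := fun z => 1 / (2 * π * p) * (-lap v z))
    (by
      filter_upwards [ae_restrict_mem measurableSet_ball] with y hy
      exact mul_nonneg (by positivity) (h.super y (hsub (ball_subset_closedBall hy))))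
    (ig.const_mul _)
    ((hi.const_mul (1 / (2 * π * p) * p)).congr (ae_of_all _ fun y => by dsimp only; ring))
    ((ie.const_mul (1 / (2 * π * p))).congr (ae_of_all _ fun y => by dsimp only; ring))
    (by
      rw [integral_const_mul, one_div, inv_mul_le_iff₀ (by positivity), mul_one]
      exact hm)
  have e1 : ∫ z in ball x0 ε, p * (Real.log (2 * ε) - Real.log ‖z - x‖) * (1 / (2 * π * p) * (-lap v z))
      = 1 / (2 * π) * ∫ z in ball x0 ε, (Real.log (2 * ε) - Real.log ‖z - x‖) * (-lap v z) := by
    rw [← integral_const_mul]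
    congr 1; ext z; field_simp
  have e2 : ∫ z in ball x0 ε, Real.exp (p * (Real.log (2 * ε) - Real.log ‖z - x‖)) * (1 / (2 * π * p) * (-lap v z))
      = 1 / (2 * π * p) * ∫ z in ball x0 ε, Real.exp (p * (Real.log (2 * ε) - Real.log ‖z - x‖)) * (-lap v z) := by
    rw [← integral_const_mul]
    congr 1; ext z; ring
  rw [e1, e2] at hJ
  refine le_trans ?_ (mul_le_mul_of_nonneg_left hJ (Real.exp_pos _).le)
  rw [← Real.exp_add]
  apply Real.exp_le_exp.2
  rw [one_div, ← div_eq_inv_mul, ← add_div, le_div_iff₀ (by positivity)]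
  linarith

lemma lintegral_pk (a D : ℝ) (z : E2) :
    ∫⁻ y in ball z D, ENNReal.ofReal (Real.exp (a * (Real.log D - Real.log ‖y - z‖)))
      = ∫⁻ y in ball (0 : E2) D, ENNReal.ofReal (Real.exp (a * (Real.log D - Real.log ‖y‖))) := by
  rw [← lintegral_indicator measurableSet_ball, ← lintegral_indicator measurableSet_ball,
    ← lintegral_sub_right_eq_self ((ball (0 : E2) D).indicator _) z]
  congr 1
  ext y
  simp [indicator, dist_eq_norm]

lemma lintegral_pk_lt_top {a : ℝ} (ha : a < 2) (D : ℝ) :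
    ∫⁻ y in ball (0 : E2) D, ENNReal.ofReal (Real.exp (a * (Real.log D - Real.log ‖y‖))) < ∞ := by
  have := (integrableOn_pk ha D 0 D).lintegral_lt_top
  simpa using this

set_option maxHeartbeats 1000000 in
lemma core {η ε : ℝ} (C b : ℝ) (hη : 0 < η) (hη1 : η < 1) (hε : 0 < ε) (hb : 0 ≤ b) :
    ∃ c : ℝ, ∀ (Ω : Set E2) (u v : E2 → ℝ) (x0 : E2), IsOpen Ω → Good Ω u C → Good Ω v C →
      closedBall x0 ε ⊆ Ω → ∫ y in ball x0 ε, -lap v y ≤ 2 * π * (2 - η) →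
      (∀ x ∈ Ω, -lap u x ≤ b * Real.exp (v x)) → u x0 ≤ c := by
  have hpi := Real.pi_pos
  set p := 2 - η with hp
  set a := 2 - η / 2 with ha
  have hp0 : 0 < p := by linarith
  have ha2 : a < 2 := by linarith
  set D := 2 * ε with hD
  set J := ∫⁻ y in ball (0 : E2) D, ENNReal.ofReal (Real.exp (a * (Real.log D - Real.log ‖y‖))) with hJ
  have hJt : J ≠ ∞ := (lintegral_pk_lt_top ha2 D).ne
  set K := b * Real.exp (8 / ε ^ 2 * C / (2 * π)) / (η / 2) with hK
  have hK0 : 0 ≤ K := by positivity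
  set N : ℝ≥0∞ := ENNReal.ofReal (2 * K) * J
    + ENNReal.ofReal (K * (1 / (2 * π * p))) * (J * ENNReal.ofReal (2 * π * p)) with hN
  have hNt : N ≠ ∞ := by
    rw [hN]
    exact ENNReal.add_ne_top.2 ⟨ENNReal.mul_ne_top ENNReal.ofReal_ne_top hJt,
      ENNReal.mul_ne_top ENNReal.ofReal_ne_top (ENNReal.mul_ne_top hJt ENNReal.ofReal_ne_top)⟩
  refine ⟨(2 / (ε / 2) ^ 2 * C + N.toReal) / (2 * π), ?_⟩
  intro Ω u v x0 hΩ hu hv hsub hm hfb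
  rw [le_div_iff₀ (by positivity), mul_comm]
  have hsub1 : closedBall x0 (ε / 2) ⊆ Ω := (closedBall_subset_closedBall (by linarith)).trans hsub
  refine (hu.upper hΩ x0 (half_pos hε) hsub1).trans (add_le_add le_rfl ?_)
  rw [← ENNReal.ofReal_le_iff_le_toReal hNt]
  have hlc : ContinuousOn (fun y => -lap u y) (closedBall x0 (ε / 2)) :=
    ((continuousOn_lap hΩ hu.smooth).mono hsub1).neg
  have hlcv : ContinuousOn (fun y => -lap v y) (closedBall x0 ε) :=
    ((continuousOn_lap hΩ hv.smooth).mono hsub).neg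
  have ig : IntegrableOn (fun y => -lap v y) (ball x0 ε) :=
    (hlcv.integrableOn_compact (isCompact_closedBall x0 ε)).mono_set ball_subset_closedBall
  have hint : IntegrableOn (fun y => (Real.log (ε / 2) - Real.log ‖y - x0‖) * (-lap u y)) (ball x0 (ε / 2)) :=
    integrableOn_mul_cont measurableSet_ball ball_subset_closedBall (isCompact_closedBall x0 (ε / 2))
        (Integrable.sub (integrableOn_const measure_ball_lt_top.ne)
          (integrableOn_log x0 (ε / 2))) hlc
  have hgnn : ∀ᵐ z ∂(volume.restrict (ball x0 ε)), 0 ≤ -lap v z := by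
    filter_upwards [ae_restrict_mem measurableSet_ball] with y hy
    exact hv.super y (hsub (ball_subset_closedBall hy))
  rw [ofReal_integral_eq_lintegral_ofReal hint (by
    filter_upwards [ae_ne_restrict x0 (ball x0 (ε / 2)), ae_restrict_mem measurableSet_ball] with y hy hyB
    have h1 : 0 < ‖y - x0‖ := norm_pos_iff.2 (sub_ne_zero.2 hy)
    have h2 : ‖y - x0‖ ≤ ε / 2 := by rw [← dist_eq_norm]; exact (mem_ball.1 hyB).le
    exact mul_nonneg (sub_nonneg.2 (Real.log_le_log h1 h2)) (hu.super y (hsub1 (ball_subset_closedBall hyB))))]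
  -- pointwise bound
  have hpt : ∀ᵐ y ∂(volume.restrict (ball x0 (ε / 2))),
      ENNReal.ofReal ((Real.log (ε / 2) - Real.log ‖y - x0‖) * (-lap u y)) ≤
        ENNReal.ofReal (2 * K) * ENNReal.ofReal (Real.exp (a * (Real.log D - Real.log ‖y - x0‖)))
        + ENNReal.ofReal (K * (1 / (2 * π * p))) * ∫⁻ z in ball x0 ε,
          ENNReal.ofReal (Real.exp (a * (Real.log D - Real.log ‖y - z‖))) * ENNReal.ofReal (-lap v z) := by
    filter_upwards [ae_ne_restrict x0 (ball x0 (ε / 2)), ae_restrict_mem measurableSet_ball] with y hy hyB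
    have h1 : 0 < ‖y - x0‖ := norm_pos_iff.2 (sub_ne_zero.2 hy)
    have h2 : ‖y - x0‖ ≤ ε / 2 := by rw [← dist_eq_norm]; exact (mem_ball.1 hyB).le
    have hyΩ : y ∈ Ω := hsub1 (ball_subset_closedBall hyB)
    have hb2 : ball x0 ε ⊆ ball y D := ball_subset_ball' (by
      rw [mem_ball] at hyB; rw [dist_comm]; linarith)
    have iek : ∀ q : ℝ, q < 2 → IntegrableOn (fun z => Real.exp (q * (Real.log D - Real.log ‖z - y‖)) * (-lap v z))
        (ball x0 ε) := fun q hq =>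
      integrableOn_mul_cont measurableSet_ball ball_subset_closedBall (isCompact_closedBall x0 ε)
        ((integrableOn_pk hq D y D).mono_set hb2) hlcv
    have hexp := hv.exp_upper hΩ hε hsub hyB hp0 (by linarith) hm
    rw [← hD] at hexp
    set l := Real.log D - Real.log ‖y - x0‖ with hl
    have hl0 : Real.log (ε / 2) - Real.log ‖y - x0‖ ≤ l := by
      have := Real.log_le_log (half_pos hε) (show ε / 2 ≤ D by linarith)
      linarith
    have hl0' : 0 ≤ Real.log (ε / 2) - Real.log ‖y - x0‖ := sub_nonneg.2 (Real.log_le_log h1 h2)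
    have hlnn : 0 ≤ l := hl0'.trans hl0
    have hlexp : l ≤ Real.exp (η / 2 * l) / (η / 2) := by
      rw [le_div_iff₀ (by positivity)]
      linarith [Real.add_one_le_exp (η / 2 * l)]
    have hlexpa : l ≤ Real.exp (a * l) / (η / 2) := by
      refine hlexp.trans ?_
      gcongr
      linarith
    set I := ∫ z in ball x0 ε, Real.exp (a * (Real.log D - Real.log ‖z - y‖)) * (-lap v z) with hI
    have hI0 : 0 ≤ I := integral_nonneg_of_ae (by
      filter_upwards [hgnn] with z hz using mul_nonneg (Real.exp_pos _).le hz)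
    have hkey : l * ∫ z in ball x0 ε, Real.exp (p * (Real.log D - Real.log ‖z - y‖)) * (-lap v z)
        ≤ (Real.exp (a * l) * (2 * π * p) + I) / (η / 2) := by
      have : l * ∫ z in ball x0 ε, Real.exp (p * (Real.log D - Real.log ‖z - y‖)) * (-lap v z)
          ≤ ∫ z in ball x0 ε, (Real.exp (a * l) * (-lap v z) +
            Real.exp (a * (Real.log D - Real.log ‖z - y‖)) * (-lap v z)) / (η / 2) := by
        rw [← integral_const_mul]
        refine integral_mono_ae ((iek p (by linarith)).const_mul _)
          (((ig.const_mul _).add (iek a ha2)).div_const _) ?_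
        filter_upwards [hgnn] with z hz
        set l2 := Real.log D - Real.log ‖z - y‖ with hl2
        have h3 : Real.exp (η / 2 * l) * Real.exp (p * l2) ≤ Real.exp (a * l) + Real.exp (a * l2) := by
          rw [← Real.exp_add]
          rcases le_total l l2 with hll | hll
          · have : Real.exp (η / 2 * l + p * l2) ≤ Real.exp (a * l2) := by
              apply Real.exp_le_exp.2
              nlinarith
            linarith [Real.exp_pos (a * l)]
          · have : Real.exp (η / 2 * l + p * l2) ≤ Real.exp (a * l) := by
              apply Real.exp_le_exp.2
              nlinarith
            linarith [Real.exp_pos (a * l2)]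
        have h4 : l * Real.exp (p * l2) ≤ (Real.exp (a * l) + Real.exp (a * l2)) / (η / 2) := by
          refine (mul_le_mul_of_nonneg_right hlexp (Real.exp_pos _).le).trans ?_
          rw [div_mul_eq_mul_div]
          gcongr
        calc l * (Real.exp (p * l2) * -lap v z) = l * Real.exp (p * l2) * (-lap v z) := by ring
          _ ≤ (Real.exp (a * l) + Real.exp (a * l2)) / (η / 2) * (-lap v z) :=
            mul_le_mul_of_nonneg_right h4 hz
          _ = _ := by ring
      refine this.trans ?_
      rw [integral_div, integral_add (ig.const_mul _) (iek a ha2), integral_const_mul]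
      gcongr
    have hIof : ∫⁻ z in ball x0 ε,
          ENNReal.ofReal (Real.exp (a * (Real.log D - Real.log ‖y - z‖))) * ENNReal.ofReal (-lap v z)
          = ENNReal.ofReal I := by
      rw [hI, ofReal_integral_eq_lintegral_ofReal (iek a ha2) (by
        filter_upwards [hgnn] with z hz using mul_nonneg (Real.exp_pos _).le hz)]
      congr 1; ext z
      rw [ENNReal.ofReal_mul (Real.exp_pos _).le, norm_sub_rev]
    have hc0 : 0 ≤ K * (1 / (2 * π * p)) := mul_nonneg hK0 (by positivity)
    have h2K : 0 ≤ 2 * K := by linarith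
    rw [hIof, ← ENNReal.ofReal_mul h2K, ← ENNReal.ofReal_mul hc0,
      ← ENNReal.ofReal_add (mul_nonneg h2K (Real.exp_pos _).le) (mul_nonneg hc0 hI0)]
    apply ENNReal.ofReal_le_ofReal
    set E := Real.exp (8 / ε ^ 2 * C / (2 * π)) with hE
    have hE0 : 0 < E := Real.exp_pos _
    set Q := ∫ z in ball x0 ε, Real.exp (p * (Real.log D - Real.log ‖z - y‖)) * (-lap v z) with hQ
    have hf0 : 0 ≤ -lap u y := hu.super y hyΩ
    calc (Real.log (ε / 2) - Real.log ‖y - x0‖) * (-lap u y) ≤ l * (-lap u y) :=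
          mul_le_mul_of_nonneg_right hl0 hf0
      _ ≤ l * (b * Real.exp (v y)) := mul_le_mul_of_nonneg_left (hfb y hyΩ) hlnn
      _ ≤ l * (b * (E * (1 + 1 / (2 * π * p) * Q))) := by gcongr
      _ = b * E * (l + 1 / (2 * π * p) * (l * Q)) := by ring
      _ ≤ b * E * (Real.exp (a * l) / (η / 2) + 1 / (2 * π * p) *
            ((Real.exp (a * l) * (2 * π * p) + I) / (η / 2))) := by gcongr
      _ = _ := by rw [hK]; field_simp; ring
  refine (lintegral_mono_ae hpt).trans ?_
  have hsubD : ∀ z ∈ ball x0 ε, ball x0 (ε / 2) ⊆ ball z D := fun z hz => ball_subset_ball' (by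
      rw [mem_ball] at hz; rw [dist_comm]; linarith)
  have hpkle : ∀ z ∈ ball x0 ε, ∫⁻ y in ball x0 (ε / 2),
      ENNReal.ofReal (Real.exp (a * (Real.log D - Real.log ‖y - z‖))) ≤ J := by
    intro z hz
    rw [hJ, ← lintegral_pk a D z]
    exact lintegral_mono_set (hsubD z hz)
  rw [lintegral_add_left (by fun_prop), lintegral_const_mul _ (by fun_prop), hN,
    lintegral_const_mul' _ _ ENNReal.ofReal_ne_top]
  refine add_le_add (mul_le_mul_right (hpkle x0 (mem_ball_self hε)) _) (mul_le_mul_right ?_ _)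
  have hgm : AEMeasurable (fun z => ENNReal.ofReal (-lap v z)) (volume.restrict (ball x0 ε)) :=
    ig.aestronglyMeasurable.aemeasurable.ennreal_ofReal
  rw [lintegral_lintegral_swap]
  · calc _ ≤ ∫⁻ z in ball x0 ε, J * ENNReal.ofReal (-lap v z) := by
          refine setLIntegral_mono_ae (by fun_prop) (ae_of_all _ fun z hz => ?_)
          rw [lintegral_mul_const _ (by fun_prop)]
          exact mul_le_mul_left (hpkle z hz) _
      _ = J * ENNReal.ofReal (∫ z in ball x0 ε, -lap v z) := by
          rw [lintegral_const_mul' _ _ hJt, ofReal_integral_eq_lintegral_ofReal ig hgnn]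
      _ ≤ _ := by gcongr
  · have hA : AEMeasurable (fun q : E2 × E2 =>
        ENNReal.ofReal (Real.exp (a * (Real.log D - Real.log ‖q.1 - q.2‖))))
        ((volume.restrict (ball x0 (ε / 2))).prod (volume.restrict (ball x0 ε))) :=
      Measurable.aemeasurable (by fun_prop)
    have hB : AEMeasurable (fun q : E2 × E2 => ENNReal.ofReal (-lap v q.2))
        ((volume.restrict (ball x0 (ε / 2))).prod (volume.restrict (ball x0 ε))) := hgm.comp_snd
    exact hA.mul hB

lemma final_mk {Ω : Set E2} (hΩo : IsOpen Ω) (hΩb : Bornology.IsBounded Ω) {u v V : E2 → ℝ} {b C : ℝ}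
    (hu : ContDiffOn ℝ 2 u (closure Ω)) (he : ∀ x ∈ Ω, -lap u x = V x * Real.exp (v x))
    (h0 : ∀ x ∈ frontier Ω, u x = 0) (hV : ∀ x ∈ Ω, 0 ≤ V x ∧ V x ≤ b)
    (hC : (∫ x in Ω, Real.exp (u x)) ≤ C) : Good Ω u C := by
  have hs : ∀ x ∈ Ω, 0 ≤ -lap u x := fun x hx => by
    rw [he x hx]; exact mul_nonneg (hV x hx).1 (Real.exp_pos _).le
  refine ⟨hu.mono subset_closure, hs, nonneg_of_super hΩo hΩb hu hs h0, ?_, hC⟩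
  exact ((Real.continuous_exp.comp_continuousOn hu.continuousOn).integrableOn_compact
    hΩb.isCompact_closure).mono_set subset_closure

/-- **Interior a priori bound for the Gelfand–Liouville system.** For solutions of the system
`-Δu = V e^v`, `-Δv = W e^u` in `Ω` with Dirichlet conditions, bounded potentials and bounded
energies, there is a uniform bound on every compact subset `K ⊆ Ω`: no interior blow-up. -/
theorem interior_bound_system (Ω : Set E2) (hΩo : IsOpen Ω) (hΩb : Bornology.IsBounded Ω)
    (hΩs : SmoothBoundary Ω) (K : Set E2) (hK : IsCompact K) (hKΩ : K ⊆ Ω)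
    (b₁ b₂ C₁ C₂ : ℝ) :
    ∃ c : ℝ, ∀ (V W u v : E2 → ℝ),
      ContDiffOn ℝ 2 u (closure Ω) →
      ContDiffOn ℝ 2 v (closure Ω) →
      (∀ x ∈ Ω, -lap u x = V x * Real.exp (v x)) →
      (∀ x ∈ Ω, -lap v x = W x * Real.exp (u x)) →
      (∀ x ∈ frontier Ω, u x = 0) →
      (∀ x ∈ frontier Ω, v x = 0) →
      (∀ x ∈ Ω, 0 ≤ V x ∧ V x ≤ b₁) →
      (∀ x ∈ Ω, 0 ≤ W x ∧ W x ≤ b₂) →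
      (∫ x in Ω, Real.exp (u x)) ≤ C₁ →
      (∫ x in Ω, Real.exp (v x)) ≤ C₂ →
      ∀ x ∈ K, u x ≤ c ∧ v x ≤ c := by
  obtain ⟨δ, hδ, hδΩ⟩ := hK.exists_cthickening_subset_open hΩo hKΩ
  have hball : ∀ x ∈ K, closedBall x δ ⊆ Ω := fun x hx =>
    (closedBall_subset_cthickening hx δ).trans hδΩ
  obtain ⟨η, ε, hη, hη1, hε, hεR, hmass⟩ := mass_bound (R := δ / 2) (half_pos hδ) (max C₁ C₂)
  obtain ⟨c, hc⟩ := core (max C₁ C₂) (max (max b₁ b₂) 0) hη hη1 hε (le_max_right _ _)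
  refine ⟨c, ?_⟩
  intro V W u v hu hv hue hve hu0 hv0 hV hW hC1 hC2 x hx
  have gu : Good Ω u (max C₁ C₂) :=
    final_mk hΩo hΩb hu hue hu0 hV (hC1.trans (le_max_left _ _))
  have gv : Good Ω v (max C₁ C₂) :=
    final_mk hΩo hΩb hv hve hv0 hW (hC2.trans (le_max_right _ _))
  have hb2 : closedBall x (2 * (δ / 2)) ⊆ Ω := by
    rw [mul_div_cancel₀ _ (by norm_num)]; exact hball x hx
  have hbε : closedBall x ε ⊆ Ω := (closedBall_subset_closedBall (by linarith)).trans (hball x hx)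
  constructor
  · refine hc Ω u v x hΩo gu gv hbε (hmass Ω v x hΩo gv hb2) fun y hy => ?_
    rw [hue y hy]
    exact mul_le_mul_of_nonneg_right ((hV y hy).2.trans ((le_max_left _ _).trans (le_max_left _ _)))
      (Real.exp_pos _).le
  · refine hc Ω v u x hΩo gv gu hbε (hmass Ω u x hΩo gu hb2) fun y hy => ?_
    rw [hve y hy]
    exact mul_le_mul_of_nonneg_right ((hW y hy).2.trans ((le_max_right _ _).trans (le_max_left _ _)))
      (Real.exp_pos _).le
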